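/- Node splitting reduces vertex-disjoint linkings to edge-disjoint flows: given a finite directed graph G with node sets 𝒜, 𝒯, construct the auxiliary graph by splitting each node x into x⁻, x⁺ with an edge (x⁻, x⁺) of capacity 1, replacing each edge (x,y) by (x⁺, y⁻) of infinite capacity, and adding a source s with edges to all x⁻, x ∈ 𝒜, and a sink t with edges from all x⁺, x ∈ 𝒯 (infinite capacity). Then the maximum s–t flow value in the auxiliary graph equals the maximum size of an (𝒜–𝒯)-linking (pairwise vertex-disjoint direct paths) in G. -/

import Mathlib

/-- A direct (A–T)-path: a nonempty simple directed path whose first node is in `A`,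
whose last node is in `T`, and which meets `A` only at its first node and `T` only
at its last node. -/
def DirectPath {V : Type} (E : V → V → Prop) (A T : Set V) (l : List V) : Prop :=
  l ≠ [] ∧ l.Chain' E ∧ l.Nodup ∧
  (∃ a ∈ A, l.head? = some a) ∧
  (∃ b ∈ T, l.getLast? = some b) ∧
  (∀ v ∈ l, v ∈ A → l.head? = some v) ∧
  (∀ v ∈ l, v ∈ T → l.getLast? = some v)

/-- An (A–T)-linking of size `p`: `p` pairwise vertex-disjoint direct (A–T)-paths. -/
def Linking {V : Type} (E : V → V → Prop) (A T : Set V) (p : ℕ)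
    (P : Fin p → List V) : Prop :=
  (∀ i, DirectPath E A T (P i)) ∧
  ∀ i j, i ≠ j → ∀ v, v ∈ P i → v ∉ P j

/-- An (A,T)-separator: a node set met by every directed path from `A` to `T`. -/
def IsSeparator {V : Type} (E : V → V → Prop) (A T S : Set V) : Prop :=
  ∀ l : List V, l ≠ [] → l.Chain' E →
    (∃ a ∈ A, l.head? = some a) → (∃ b ∈ T, l.getLast? = some b) →
    ∃ v ∈ l, v ∈ S

/-- Vertex set of the auxiliary node-split graph: `Sum.inl (x, false)` is `x⁻`,
`Sum.inl (x, true)` is `x⁺`, `Sum.inr false` is the source `s`, and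
`Sum.inr true` is the sink `t`. -/
abbrev AuxV (V : Type) : Type := (V × Bool) ⊕ Bool

open Classical in
/-- Capacities of the auxiliary graph: node-splitting edges `(x⁻, x⁺)` have
capacity 1; edges `(x⁺, y⁻)` for `E x y`, `(s, x⁻)` for `x ∈ A`, and `(x⁺, t)`
for `x ∈ T` have infinite capacity; all other pairs have capacity 0 (no edge). -/
noncomputable def auxCap {V : Type} (E : V → V → Prop) (A T : Set V) :
    AuxV V → AuxV V → ℕ∞
  | .inl (x, false), .inl (y, true) => if x = y then 1 else 0
  | .inl (x, true), .inl (y, false) => if E x y then ⊤ else 0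
  | .inr false, .inl (x, false) => if x ∈ A then ⊤ else 0
  | .inl (x, true), .inr true => if x ∈ T then ⊤ else 0
  | _, _ => 0

/-- An integer-valued `s`–`t` flow: capacity constraints on every pair, and flow
conservation at every node other than the source and the sink. -/
def IsFlow {V : Type} [Fintype V] (cap : AuxV V → AuxV V → ℕ∞)
    (f : AuxV V → AuxV V → ℕ) : Prop :=
  (∀ a b, (f a b : ℕ∞) ≤ cap a b) ∧
  ∀ v : AuxV V, v ≠ Sum.inr false → v ≠ Sum.inr true →
    ∑ a, f a v = ∑ b, f v b

/-- The value of a flow: total flow leaving the source. -/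
def flowValue {V : Type} [Fintype V] (f : AuxV V → AuxV V → ℕ) : ℕ :=
  ∑ b, f (Sum.inr false) b

open Classical in
/-- The capacity of the cut determined by a source set `W`. -/
noncomputable def cutCap {V : Type} [Fintype V] (cap : AuxV V → AuxV V → ℕ∞)
    (W : Set (AuxV V)) : ℕ∞ :=
  ∑ a, ∑ b, if a ∈ W ∧ b ∉ W then cap a b else 0

open Classical in
/-- The unit flow of the auxiliary graph along the node list `l`. -/
noncomputable def listFlow {V : Type} (l : List V) : AuxV V → AuxV V → ℕ
  | .inl (x, false), .inl (y, true) => if x = y then l.count x else 0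
  | .inl (x, true), .inl (y, false) => (l.zip l.tail).count (x, y)
  | .inr false, .inl (x, false) => if l.head? = some x then 1 else 0
  | .inl (x, true), .inr true => if l.getLast? = some x then 1 else 0
  | _, _ => 0

theorem sum_count_prod_left {V : Type} [Fintype V] [DecidableEq V] (m : List (V × V)) (x : V) :
    ∑ y, m.count (y, x) = (m.map Prod.snd).count x := by
  induction m with
  | nil => simp
  | cons p m ih =>
    obtain ⟨a, b⟩ := p
    by_cases h : b = x <;> simp [List.count_cons, Finset.sum_add_distrib, ih, h]

theorem sum_count_prod_right {V : Type} [Fintype V] [DecidableEq V] (m : List (V × V)) (x : V) :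
    ∑ y, m.count (x, y) = (m.map Prod.fst).count x := by
  induction m with
  | nil => simp
  | cons p m ih =>
    obtain ⟨a, b⟩ := p
    by_cases h : a = x <;> simp [List.count_cons, Finset.sum_add_distrib, ih, h]

theorem map_snd_zip_tail {V : Type} (l : List V) : (l.zip l.tail).map Prod.snd = l.tail :=
  List.map_snd_zip (by simp)

theorem map_fst_zip_tail {V : Type} (l : List V) :
    (l.zip l.tail).map Prod.fst = l.dropLast := by
  induction l with
  | nil => rfl
  | cons a l ih =>
    cases l with
    | nil => rfl
    | cons b l => simpa using ih

theorem count_eq_head_add_tail {V : Type} [DecidableEq V] (l : List V) (x : V) :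
    l.count x = (if l.head? = some x then 1 else 0) + l.tail.count x := by
  cases l with
  | nil => simp
  | cons a l => simp [List.count_cons, add_comm]

theorem count_eq_dropLast_add_getLast {V : Type} [DecidableEq V] (l : List V) (x : V) :
    l.count x = l.dropLast.count x + (if l.getLast? = some x then 1 else 0) := by
  induction l using List.reverseRecOn with
  | nil => simp
  | append_singleton l a => simp [List.count_append, List.count_singleton]

theorem listFlow_conserves {V : Type} [Fintype V] (l : List V) (v : AuxV V)
    (hs : v ≠ Sum.inr false) (ht : v ≠ Sum.inr true) :
    ∑ a, listFlow l a v = ∑ b, listFlow l v b := by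
  classical
  rcases v with ⟨x, _ | _⟩ | _ | _
  · have h := sum_count_prod_left (l.zip l.tail) x
    rw [map_snd_zip_tail] at h
    have h' := count_eq_head_add_tail l x
    simp only [Fintype.sum_sum_type, Fintype.sum_prod_type, Fintype.sum_bool, listFlow]
    simp
    rw [h, h', add_comm]
  · have h := sum_count_prod_right (l.zip l.tail) x
    rw [map_fst_zip_tail] at h
    have h' := count_eq_dropLast_add_getLast l x
    simp only [Fintype.sum_sum_type, Fintype.sum_prod_type, Fintype.sum_bool, listFlow]
    simp
    rw [h, h']
  · exact absurd rfl hs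
  · exact absurd rfl ht

theorem flowValue_listFlow {V : Type} [Fintype V] {l : List V} (hl : l ≠ []) :
    flowValue (listFlow l) = 1 := by
  cases l with
  | nil => exact absurd rfl hl
  | cons a l =>
    simp [flowValue, listFlow, Fintype.sum_sum_type, Fintype.sum_prod_type]
    rw [Finset.sum_eq_single a] <;> simp +contextual [eq_comm]

theorem rel_of_mem_zip_tail {V : Type} {E : V → V → Prop} {l : List V} (hl : l.IsChain E)
    {x y : V} (h : (x, y) ∈ l.zip l.tail) : E x y := by
  induction l with
  | nil => simp at h
  | cons a l ih =>
    cases l with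
    | nil => simp at h
    | cons b l =>
      rw [List.isChain_cons_cons] at hl
      rw [List.tail_cons, List.zip_cons_cons, List.mem_cons] at h
      rcases h with h | h
      · obtain ⟨rfl, rfl⟩ := Prod.mk.inj h
        exact hl.1
      · exact ih hl.2 h

theorem sum_count_le_one {V : Type} [DecidableEq V] {p : ℕ} {P : Fin p → List V}
    (hn : ∀ i, (P i).Nodup) (hd : ∀ i j, i ≠ j → ∀ v, v ∈ P i → v ∉ P j) (x : V) :
    ∑ i, (P i).count x ≤ 1 := by
  by_cases h : ∃ i, x ∈ P i
  · obtain ⟨i, hi⟩ := h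
    rw [Finset.sum_eq_single i]
    · exact List.nodup_iff_count_le_one.1 (hn i) x
    · exact fun j _ hj => List.count_eq_zero_of_not_mem (hd i j hj.symm x hi)
    · simp
  · push Not at h
    simp [List.count_eq_zero_of_not_mem (h _)]

theorem exists_flow_of_linking {V : Type} [Fintype V] {E : V → V → Prop} {A T : Set V} {p : ℕ}
    {P : Fin p → List V} (h : Linking E A T p P) :
    ∃ f, IsFlow (auxCap E A T) f ∧ flowValue f = p := by
  classical
  obtain ⟨hP, hd⟩ := h
  refine ⟨fun a b => ∑ i, listFlow (P i) a b, ⟨?_, ?_⟩, ?_⟩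
  · rintro (⟨x, _ | _⟩ | _ | _) (⟨y, _ | _⟩ | _ | _) <;>
      simp only [auxCap, listFlow, Finset.sum_const_zero, Nat.cast_zero, le_refl]
    · split_ifs
      · exact_mod_cast (by convert sum_count_le_one (fun i => (hP i).2.2.1) hd x)
      · simp
    · split_ifs with hE
      · exact le_top
      · simp only [nonpos_iff_eq_zero, Nat.cast_eq_zero, Finset.sum_eq_zero_iff]
        exact fun i _ => List.count_eq_zero_of_not_mem
          fun hm => hE (rel_of_mem_zip_tail (hP i).2.1 hm)
    · split_ifs with hT
      · exact le_top
      · simp only [nonpos_iff_eq_zero, Nat.cast_eq_zero, Finset.sum_eq_zero_iff]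
        refine fun i _ => if_neg fun hx => ?_
        obtain ⟨b, hb, hb'⟩ := (hP i).2.2.2.2.1
        exact hT (Option.some.inj (hx.symm.trans hb') ▸ hb)
    · split_ifs with hA
      · exact le_top
      · simp only [nonpos_iff_eq_zero, Nat.cast_eq_zero, Finset.sum_eq_zero_iff]
        refine fun i _ => if_neg fun hx => ?_
        obtain ⟨b, hb, hb'⟩ := (hP i).2.2.2.1
        exact hA (Option.some.inj (hx.symm.trans hb') ▸ hb)
  · intro v hs ht
    rw [Finset.sum_comm, Finset.sum_comm (s := Finset.univ (α := AuxV V))]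
    exact Finset.sum_congr rfl fun i _ => listFlow_conserves (P i) v hs ht
  · have h1 := fun i => flowValue_listFlow (hP i).1
    unfold flowValue at h1 ⊢
    rw [Finset.sum_comm]
    simp [h1]

theorem exists_directPath_subset {V : Type} {E : V → V → Prop} {A T : Set V} (l : List V)
    (hc : l.IsChain E) (ha : ∃ a ∈ A, l.head? = some a) (hb : ∃ b ∈ T, l.getLast? = some b) :
    ∃ l', DirectPath E A T l' ∧ l' ⊆ l := by
  induction hn : l.length using Nat.strong_induction_on generalizing l with
  | _ n ih =>
  subst hn
  have hne : l ≠ [] := by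
    rintro rfl
    simp at ha
  have shorten : ∀ l', l'.length < l.length → l'.IsChain E → (∃ a ∈ A, l'.head? = some a) →
      (∃ b ∈ T, l'.getLast? = some b) → l' ⊆ l → ∃ l', DirectPath E A T l' ∧ l' ⊆ l := by
    intro l' hlt hc' ha' hb' hsub
    obtain ⟨m, hm, hm'⟩ := ih _ hlt l' hc' ha' hb' rfl
    exact ⟨m, hm, List.Subset.trans hm' hsub⟩
  by_cases hnd : l.Nodup
  swap
  · rw [← List.exists_duplicate_iff_not_nodup] at hnd
    obtain ⟨x, hx⟩ := hnd
    obtain ⟨s, t, u, rfl⟩ : ∃ s t u, l = s ++ x :: (t ++ x :: u) := by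
      clear ih shorten hc ha hb hne
      induction hx with
      | cons_mem h =>
        obtain ⟨t, u, rfl⟩ := List.append_of_mem h
        exact ⟨[], t, u, rfl⟩
      | cons_duplicate _ ih =>
        obtain ⟨s, t, u, rfl⟩ := ih
        exact ⟨_ :: s, t, u, rfl⟩
    refine shorten (s ++ x :: u) (by simp) ?_ ?_ ?_ ?_
    · rw [List.isChain_split] at hc ⊢
      refine ⟨hc.1, ?_⟩
      have := hc.2
      rw [← List.cons_append, List.isChain_split] at this
      exact this.2
    · cases s <;> simpa using ha
    · simpa [List.getLast?_append, List.getLast?_cons] using hb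
    · intro v hv
      simp only [List.mem_append, List.mem_cons] at hv ⊢
      tauto
  by_cases hA : ∀ v ∈ l, v ∈ A → l.head? = some v
  swap
  · push Not at hA
    obtain ⟨v, hv, hvA, hh⟩ := hA
    obtain ⟨s, u, rfl⟩ := List.append_of_mem hv
    have hs : s ≠ [] := by
      rintro rfl
      simp at hh
    refine shorten (v :: u) ?_ (List.isChain_split.1 hc).2 ⟨v, hvA, rfl⟩ ?_ (by simp)
    · have := List.length_pos_iff.2 hs
      simp; omega
    · simpa [List.getLast?_append, List.getLast?_cons] using hb
  by_cases hT : ∀ v ∈ l, v ∈ T → l.getLast? = some v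
  swap
  · push Not at hT
    obtain ⟨v, hv, hvT, hh⟩ := hT
    obtain ⟨s, u, rfl⟩ := List.append_of_mem hv
    have hu : u ≠ [] := by
      rintro rfl
      simp at hh
    refine shorten (s ++ [v]) ?_ (List.isChain_split.1 hc).1 ?_ ⟨v, hvT, by simp⟩ (by simp)
    · have := List.length_pos_iff.2 hu
      simp; omega
    · cases s <;> simpa using ha
  exact ⟨l, ⟨hne, hc, hnd, ha, hb, hA, hT⟩, List.Subset.refl l⟩

/-- In a finite relation with at most one predecessor for each element, a forward walk from
an element without predecessors must reach an element of `L`, if only those may lack a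
successor. -/
theorem exists_reachable_of_left_unique {V : Type} [Finite V] {N : V → V → Prop} {L : V → Prop}
    (hN : ∀ x y z, N x z → N y z → x = y) {h : V} (hh : ∀ y, ¬ N y h)
    (hout : ∀ x, Relation.ReflTransGen N h x → L x ∨ ∃ y, N x y) :
    ∃ x, L x ∧ Relation.ReflTransGen N h x := by
  by_contra! hL
  have hnext : ∀ x : {x // Relation.ReflTransGen N h x},
      ∃ y : {x // Relation.ReflTransGen N h x}, N x y := fun x =>
    have ⟨y, hy⟩ := (hout x x.2).resolve_left fun hx => hL x hx x.2
    ⟨⟨y, x.2.tail hy⟩, hy⟩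
  choose g hg using hnext
  have hinj : Function.Injective g := fun x y hxy =>
    Subtype.ext (hN _ _ _ (hg x) (hxy ▸ hg y))
  obtain ⟨x, hx⟩ := Finite.surjective_of_injective hinj ⟨h, .refl⟩
  exact hh x (by simpa [hx] using hg x)

theorem eq_of_reachable_common {V : Type} {N : V → V → Prop}
    (hN : ∀ x y z, N x z → N y z → x = y) {h h' v : V} (hh : ∀ y, ¬ N y h) (hh' : ∀ y, ¬ N y h')
    (hv : Relation.ReflTransGen N h v) (hv' : Relation.ReflTransGen N h' v) : h = h' := by
  induction hv with
  | refl =>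
    rcases Relation.ReflTransGen.cases_tail hv' with e | ⟨c, _, hc⟩
    · exact e
    · exact absurd hc (hh c)
  | tail _ hbc ih =>
    rcases Relation.ReflTransGen.cases_tail hv' with e | ⟨d, hd, hdc⟩
    · exact absurd (e ▸ hbc) (hh' _)
    · exact ih (hN _ _ _ hbc hdc ▸ hd)

theorem exists_linking_of_flow {V : Type} [Fintype V] {E : V → V → Prop} {A T : Set V}
    {f : AuxV V → AuxV V → ℕ} (hf : IsFlow (auxCap E A T) f) :
    ∃ P : Fin (flowValue f) → List V, Linking E A T (flowValue f) P := by
  classical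
  obtain ⟨hcap, hcons⟩ := hf
  have hzero : ∀ a b, auxCap E A T a b = 0 → f a b = 0 := fun a b h => by
    simpa [h] using hcap a b
  have hmid : ∀ x, f (.inl (x, false)) (.inl (x, true)) ≤ 1 := fun x => by
    simpa [auxCap] using hcap (.inl (x, false)) (.inl (x, true))
  have hmid' : ∀ x y, x ≠ y → f (.inl (x, false)) (.inl (y, true)) = 0 := fun x y hxy =>
    hzero _ _ (by simp [auxCap, hxy])
  have hin : ∀ x, f (.inr false) (.inl (x, false)) +
      ∑ y, f (.inl (y, true)) (.inl (x, false)) = f (.inl (x, false)) (.inl (x, true)) := by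
    intro x
    have h := hcons (.inl (x, false)) (by simp) (by simp)
    simp only [Fintype.sum_sum_type, Fintype.sum_prod_type, Fintype.sum_bool,
      Finset.sum_add_distrib] at h
    rw [Finset.sum_eq_single x (fun y _ hy => hmid' x y hy.symm) (by simp)] at h
    simp only [hzero (.inl (_, false)) (.inl (_, false)) rfl, hzero (.inr true) _ rfl,
      hzero (.inl (x, false)) (.inr _) rfl, Finset.sum_const_zero] at h
    omega
  have hout : ∀ x, f (.inl (x, false)) (.inl (x, true)) =
      ∑ y, f (.inl (x, true)) (.inl (y, false)) + f (.inl (x, true)) (.inr true) := by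
    intro x
    have h := hcons (.inl (x, true)) (by simp) (by simp)
    simp only [Fintype.sum_sum_type, Fintype.sum_prod_type, Fintype.sum_bool,
      Finset.sum_add_distrib] at h
    rw [Finset.sum_eq_single x (fun y _ hy => hmid' y x hy) (by simp)] at h
    simp only [hzero (.inl (_, true)) (.inl (_, true)) rfl, hzero (.inr false) (.inl (_, true)) rfl,
      hzero (.inr true) _ rfl,
      hzero (.inl (x, true)) (.inr false) rfl, Finset.sum_const_zero] at h
    omega
  set N : V → V → Prop := fun x y => f (.inl (x, true)) (.inl (y, false)) ≠ 0 with hNdef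
  have hNle : ∀ x y, f (.inl (x, true)) (.inl (y, false)) ≤
      ∑ y', f (.inl (y', true)) (.inl (y, false)) := fun x y =>
    Finset.single_le_sum (f := fun x => f (.inl (x, true)) (.inl (y, false)))
      (fun _ _ => Nat.zero_le _) (Finset.mem_univ x)
  have hNuniq : ∀ x y z, N x z → N y z → x = y := by
    intro x y z hx hy
    by_contra hxy
    have h2 := Finset.sum_le_sum_of_subset (f := fun x => f (.inl (x, true)) (.inl (z, false)))
      (Finset.subset_univ {x, y})
    rw [Finset.sum_pair hxy] at h2
    have h3 := hin z
    have h4 := hmid z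
    simp only [hNdef] at hx hy
    omega
  have hNE : ∀ x y, N x y → E x y := fun x y h => by
    by_contra hE
    exact h (hzero _ _ (by simp [auxCap, hE]))
  set H : Finset V := {x | f (.inr false) (.inl (x, false)) ≠ 0} with hH
  have hHN : ∀ h ∈ H, ∀ y, ¬ N y h := by
    intro h hh y hy
    have h1 := hNle y h
    have h2 := hin h
    have h3 := hmid h
    simp only [hH, Finset.mem_filter_univ] at hh
    simp only [hNdef] at hy
    omega
  have hHA : ∀ h ∈ H, h ∈ A := fun h hh => by
    by_contra hA
    simp only [hH, Finset.mem_filter_univ] at hh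
    exact hh (hzero _ _ (by simp [auxCap, hA]))
  have hcard : flowValue f = H.card := by
    simp only [flowValue, Fintype.sum_sum_type, Fintype.sum_prod_type, Fintype.sum_bool,
      hzero (.inr false) (.inr _) rfl, hzero (.inr false) (.inl (_, true)) rfl, zero_add, add_zero,
      hH, Finset.card_filter]
    refine Finset.sum_congr rfl fun x _ => ?_
    have h2 := hin x
    have h3 := hmid x
    split_ifs <;> omega
  have hsucc : ∀ h ∈ H, ∀ x, Relation.ReflTransGen N h x →
      f (.inl (x, true)) (.inr true) ≠ 0 ∨ ∃ y, N x y := by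
    intro h hh x hx
    have hpos : f (.inl (x, false)) (.inl (x, true)) ≠ 0 := by
      have h2 := hin x
      rcases Relation.ReflTransGen.cases_tail hx with e | ⟨c, _, hc⟩
      · subst e
        simp only [hH, Finset.mem_filter_univ] at hh
        omega
      · have h1 := hNle c x
        simp only [hNdef] at hc
        omega
    by_contra! hcon
    simp only [hNdef, not_not] at hcon
    exact hpos ((hout x).trans (by simp [hcon]))
  have hpath : ∀ h : H, ∃ l, DirectPath E A T l ∧ ∀ v ∈ l, Relation.ReflTransGen N h v := by
    rintro ⟨h, hh⟩
    obtain ⟨t, ht, hreach⟩ := exists_reachable_of_left_unique hNuniq (hHN h hh) (hsucc h hh)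
    obtain ⟨l, hl, hlast⟩ := List.exists_isChain_cons_of_relationReflTransGen hreach
    have htT : t ∈ T := by
      by_contra hT
      exact ht (hzero _ _ (by simp [auxCap, hT]))
    obtain ⟨l', hl', hsub⟩ := exists_directPath_subset (E := E) (A := A) (T := T) (h :: l)
      (hl.imp hNE) ⟨h, hHA h hh, rfl⟩
      ⟨t, htT, by rw [List.getLast?_eq_some_getLast (List.cons_ne_nil h l), hlast]⟩
    refine ⟨l', hl', fun v hv => ?_⟩
    exact hl.induction (Relation.ReflTransGen N h) _ (fun _ _ hxy hx => hx.tail hxy)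
      (fun _ => .refl) v (hsub hv)
  choose Q hQ hQreach using hpath
  rw [hcard]
  refine ⟨fun i => Q (H.equivFin.symm i), fun i => hQ _, fun i j hij v hi hj => hij ?_⟩
  have := eq_of_reachable_common hNuniq (hHN _ (H.equivFin.symm i).2) (hHN _ (H.equivFin.symm j).2)
    (hQreach _ v hi) (hQreach _ v hj)
  exact H.equivFin.symm.injective (Subtype.ext this)

theorem linking_size_le_card {V : Type} [Fintype V] {E : V → V → Prop} {A T : Set V} {p : ℕ}
    {P : Fin p → List V} (h : Linking E A T p P) : p ≤ Fintype.card V := by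
  have hinj : Function.Injective fun i => (P i).head (h.1 i).1 := by
    intro i j hij
    by_contra hne
    refine h.2 i j hne _ (List.head_mem (h.1 i).1) ?_
    have hij : (P i).head (h.1 i).1 = (P j).head (h.1 j).1 := hij
    rw [hij]
    exact List.head_mem _
  simpa using Fintype.card_le_of_injective _ hinj

/-- Node splitting reduces vertex-disjoint linkings to flows: the maximum `s`–`t`
flow value in the auxiliary graph equals the maximum size of an (A–T)-linking. -/
theorem maxflow_eq_max_linking {V : Type} [Fintype V] [DecidableEq V]
    (E : V → V → Prop) (A T : Set V) :
    ∃ F : ℕ,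
      (∃ f, IsFlow (auxCap E A T) f ∧ flowValue f = F) ∧
      (∀ f, IsFlow (auxCap E A T) f → flowValue f ≤ F) ∧
      (∃ P : Fin F → List V, Linking E A T F P) ∧
      (∀ q (P : Fin q → List V), Linking E A T q P → q ≤ F) := by
  classical
  let p : ℕ → Prop := fun q => ∃ P : Fin q → List V, Linking E A T q P
  have hbound : ∀ q, p q → q ≤ Fintype.card V := fun q ⟨_, hP⟩ => linking_size_le_card hP
  have h0 : p 0 := ⟨fun i => i.elim0, fun i => i.elim0, fun i => i.elim0⟩
  have hmax : ∀ q, p q → q ≤ Nat.findGreatest p (Fintype.card V) := fun q hq =>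
    Nat.le_findGreatest (hbound q hq) hq
  obtain ⟨P, hP⟩ := Nat.findGreatest_spec (Nat.zero_le _) h0
  exact ⟨_, exists_flow_of_linking hP, fun f hf => hmax _ (exists_linking_of_flow hf), ⟨P, hP⟩,
    fun q Q hQ => hmax q ⟨Q, hQ⟩⟩
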